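/- arXiv:1610.09774 — 4 statements merged into one kernel-verified Lean document; each statement's English description precedes it below -/
import Mathlib

section
/- For every integer k ≥ 0 there exists a finite sequence over an alphabet of 2^(2^k) symbols in which every symbol of the alphabet occurs exactly 2^k times and which avoids alternations of length k+4. -/
/-- The alternating sequence `a, b, a, b, ...` of length `k`. -/
def altSeq {α : Type*} (a b : α) : ℕ → List α
  | 0 => []
  | k + 1 => a :: altSeq b a k

/-- `l` avoids alternations of length `k`: it has no (not necessarily contiguous)
subsequence `a, b, a, b, ...` of length `k` with `a ≠ b`. -/
def AvoidsAlt {α : Type*} (l : List α) (k : ℕ) : Prop :=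
  ∀ a b : α, a ≠ b → ¬ (altSeq a b k).Sublist l

/-- `l` is an order-`s` Davenport–Schinzel sequence over an alphabet of `n` symbols:
no two consecutive entries are equal and it avoids alternations of length `s + 2`. -/
def IsDS (s n : ℕ) (l : List (Fin n)) : Prop :=
  l.Chain' (· ≠ ·) ∧ AvoidsAlt l (s + 2)

/-- `lambdaDS s n` is the maximum length of an order-`s` Davenport–Schinzel
sequence over an alphabet of `n` symbols. -/
noncomputable def lambdaDS (s n : ℕ) : ℕ :=
  sSup { L | ∃ l : List (Fin n), IsDS s n l ∧ l.length = L }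

section AltSeq

variable {α β : Type*}

theorem length_altSeq (a b : α) (n : ℕ) : (altSeq a b n).length = n := by
  induction n generalizing a b with
  | zero => rfl
  | succ n ih => simp [altSeq, ih]

theorem map_altSeq (f : α → β) (a b : α) (n : ℕ) :
    (altSeq a b n).map f = altSeq (f a) (f b) n := by
  induction n generalizing a b with
  | zero => rfl
  | succ n ih => simp [altSeq, ih]

theorem mem_altSeq {a b c : α} {n : ℕ} (h : c ∈ altSeq a b n) : c = a ∨ c = b := by
  induction n generalizing a b with
  | zero => simp [altSeq] at h
  | succ n ih =>
    rcases List.mem_cons.1 h with h | h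
    · exact .inl h
    · exact (ih h).symm

theorem altSeq_sublist_altSeq (a b : α) {m n : ℕ} (h : m ≤ n) :
    (altSeq a b m).Sublist (altSeq a b n) := by
  induction n generalizing a b m with
  | zero => simp [Nat.le_zero.1 h, altSeq]
  | succ n ih =>
    cases m with
    | zero => simp [altSeq]
    | succ m => exact (ih b a (by omega)).cons_cons a

theorem AvoidsAlt.lt_of_sublist {l : List α} {m n : ℕ} (h : AvoidsAlt l m) {a b : α}
    (hab : a ≠ b) (hs : (altSeq a b n).Sublist l) : n < m := by
  by_contra! hmn
  exact h a b hab ((altSeq_sublist_altSeq a b hmn).trans hs)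

theorem altSeq_add (a b : α) (i : ℕ) :
    ∃ c d, (c = a ∧ d = b ∨ c = b ∧ d = a) ∧
      (∀ j, altSeq a b (i + j) = altSeq a b i ++ altSeq c d j) ∧
      (1 ≤ i → ∃ u, altSeq a b i = u ++ [d]) := by
  induction i generalizing a b with
  | zero => exact ⟨a, b, by simp, by simp [altSeq], by simp⟩
  | succ i ih =>
    obtain ⟨c, d, hcd, hadd, hlast⟩ := ih b a
    refine ⟨c, d, hcd.symm, fun j => ?_, fun _ => ?_⟩
    · rw [Nat.add_right_comm]
      simp [altSeq, hadd]
    · rcases Nat.eq_zero_or_pos i with rfl | hi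
      · have h2 := hadd 2
        simp only [altSeq, List.nil_append, List.cons.injEq, and_true] at h2
        exact ⟨[], by simp [altSeq, h2.2]⟩
      · obtain ⟨u, hu⟩ := hlast hi
        exact ⟨a :: u, by simp [altSeq, hu]⟩

theorem AvoidsAlt.map {l : List α} {n : ℕ} (h : AvoidsAlt l n) (e : α ≃ β) :
    AvoidsAlt (l.map e) n := by
  intro a b hab hs
  refine h (e.symm a) (e.symm b) (by simpa using hab) ?_
  have := hs.map e.symm
  simpa [map_altSeq] using this

end AltSeq

section Sublist

variable {α β : Type*}

theorem append_pair_sublist_of_dedup [DecidableEq α] {l u : List α} {c d : α}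
    (hdc : [d, c].Sublist l.dedup) (hu : (u ++ [d]).Sublist l) : (u ++ [d, c]).Sublist l := by
  induction l generalizing u with
  | nil => simp at hu
  | cons e l ih =>
    have key : [d, c].Sublist l.dedup → (u ++ [d, c]).Sublist (e :: l) := by
      intro hdc'
      cases u with
      | nil => exact (hdc'.trans (List.dedup_sublist l)).cons e
      | cons z u =>
        rcases List.sublist_cons_iff.1 hu with h | ⟨r, hr, h⟩
        · exact (ih hdc' h).cons e
        · simp only [List.cons_append, List.cons.injEq] at hr
          obtain ⟨rfl, rfl⟩ := hr
          exact (ih hdc' h).cons_cons _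
    by_cases he : e ∈ l
    · exact key (by rwa [List.dedup_cons_of_mem he] at hdc)
    · rw [List.dedup_cons_of_notMem he] at hdc
      rcases List.sublist_cons_iff.1 hdc with h | ⟨r, hr, h⟩
      · exact key h
      · simp only [List.cons.injEq] at hr
        obtain ⟨rfl, rfl⟩ := hr
        cases u with
        | nil => exact (h.trans (List.dedup_sublist l)).cons_cons _
        | cons z u =>
          refine absurd ?_ he
          rcases List.sublist_cons_iff.1 hu with h | ⟨r, hr, h⟩
          · exact h.subset (by simp)
          · simp only [List.cons_append, List.cons.injEq] at hr
            obtain ⟨rfl, rfl⟩ := hr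
            exact h.subset (by simp)

theorem List.Nodup.eq_of_pair_sublist {l : List α} (hl : l.Nodup) {a b : α}
    (h₁ : [a, b].Sublist l) (h₂ : [b, a].Sublist l) : a = b := by
  induction l with
  | nil => simp at h₁
  | cons e l ih =>
    rw [List.nodup_cons] at hl
    rcases List.sublist_cons_iff.1 h₁ with h | ⟨r, hr, h⟩
    · rcases List.sublist_cons_iff.1 h₂ with h' | ⟨r', hr', h'⟩
      · exact ih hl.2 h h'
      · simp only [List.cons.injEq] at hr'
        exact absurd (h.subset (by simp [hr'.1])) hl.1
    · simp only [List.cons.injEq] at hr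
      obtain ⟨rfl, rfl⟩ := hr
      rcases List.sublist_cons_iff.1 h₂ with h' | ⟨r', hr', h'⟩
      · exact absurd (h'.subset (by simp)) hl.1
      · simp only [List.cons.injEq] at hr'
        exact hr'.1.symm

variable {key : β → α} {f : α → List β}

theorem pair_sublist_of_flatMap (hf : ∀ x, ∀ p ∈ f x, key p = x) {L : List α} {p q : β}
    (hpq : key p ≠ key q) (h : [p, q].Sublist (L.flatMap f)) : [key p, key q].Sublist L := by
  have hL : (L.flatMap f).Pairwise fun p q => key p = key q ∨ [key p, key q].Sublist L := by
    rw [List.pairwise_flatMap]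
    refine ⟨fun x _ => ?_, ?_⟩
    · rw [List.pairwise_iff_forall_sublist]
      intro r s hrs
      left
      rw [hf x r (hrs.subset (by simp)), hf x s (hrs.subset (by simp))]
    · rw [List.pairwise_iff_forall_sublist]
      intro x y hxy r hr s hs
      right
      rwa [hf x r hr, hf y s hs]
  exact (List.pairwise_iff_forall_sublist.1 hL h).resolve_left hpq

theorem le_two_of_altSeq_sublist_flatMap (hf : ∀ x, ∀ p ∈ f x, key p = x) {L : List α}
    (hL : L.Nodup) {p q : β} (hpq : key p ≠ key q) {n : ℕ}
    (h : (altSeq p q n).Sublist (L.flatMap f)) : n ≤ 2 := by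
  by_contra! hn
  have h3 : [p, q, p].Sublist (L.flatMap f) := (altSeq_sublist_altSeq p q hn).trans h
  refine hpq (hL.eq_of_pair_sublist
    (pair_sublist_of_flatMap hf hpq (.trans ?_ h3))
    (pair_sublist_of_flatMap hf hpq.symm (.trans ?_ h3)))
  · exact (List.sublist_append_left [p, q] [p])
  · exact (List.sublist_cons_self p [q, p])

theorem sublist_of_sublist_flatMap (hf : ∀ x, ∀ p ∈ f x, key p = x) {L : List α}
    (hL : L.Nodup) {s : List β} {x : α} (hs : ∀ p ∈ s, key p = x)
    (h : s.Sublist (L.flatMap f)) : s.Sublist (f x) := by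
  induction L generalizing s with
  | nil => simp_all
  | cons z L ih =>
    rw [List.nodup_cons] at hL
    rw [List.flatMap_cons] at h
    obtain ⟨s₁, s₂, rfl, h₁, h₂⟩ := List.sublist_append_iff.1 h
    by_cases hz : z = x
    · subst hz
      have : s₂ = [] := by
        refine List.eq_nil_iff_forall_not_mem.2 fun p hp => hL.1 ?_
        obtain ⟨y, hy, hpy⟩ := List.mem_flatMap.1 (h₂.subset hp)
        rwa [← hs p (by simp [hp]), hf y p hpy]
      simpa [this] using h₁
    · have : s₁ = [] := by
        refine List.eq_nil_iff_forall_not_mem.2 fun p hp => hz ?_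
        rw [← hs p (by simp [hp]), hf z p (h₁.subset hp)]
      subst this
      exact ih hL.2 (by simpa using hs) h₂

end Sublist

section Square

variable {α : Type*}

/-- The rows of `α × α`, each carrying a copy of `l`, in the reverse order of the first
occurrences in `l`. -/
def rowCopies [DecidableEq α] (l : List α) : List (α × α) :=
  l.reverse.dedup.flatMap fun x => l.map fun y => (x, y)

/-- The columns of `α × α`, each carrying a copy of `l`, in the reverse order of the last
occurrences in `l`. -/
def colCopies [DecidableEq α] (l : List α) : List (α × α) :=
  l.dedup.reverse.flatMap fun y => l.map fun x => (x, y)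

theorem fst_of_mem_row (l : List α) (x : α) : ∀ p ∈ l.map fun y => (x, y), p.1 = x := by
  simp +contextual

theorem snd_of_mem_col (l : List α) (y : α) : ∀ p ∈ l.map fun x => (x, y), p.2 = y := by
  simp +contextual

theorem altSeq_sublist_of_rowCopies [DecidableEq α] {l : List α} {x y y' : α} {n : ℕ}
    (h : (altSeq (x, y) (x, y') n).Sublist (rowCopies l)) : (altSeq y y' n).Sublist l := by
  have := sublist_of_sublist_flatMap (key := Prod.fst) (x := x) (fst_of_mem_row l)
    (List.nodup_dedup _) (fun p hp => by rcases mem_altSeq hp with rfl | rfl <;> rfl) h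
  simpa [map_altSeq, Function.comp_def] using this.map Prod.snd

theorem altSeq_sublist_of_colCopies [DecidableEq α] {l : List α} {x x' y : α} {n : ℕ}
    (h : (altSeq (x, y) (x', y) n).Sublist (colCopies l)) : (altSeq x x' n).Sublist l := by
  have := sublist_of_sublist_flatMap (key := Prod.snd) (x := y) (snd_of_mem_col l)
    (List.nodup_reverse.2 (List.nodup_dedup _))
    (fun p hp => by rcases mem_altSeq hp with rfl | rfl <;> rfl) h
  simpa [map_altSeq, Function.comp_def] using this.map Prod.fst

theorem AvoidsAlt.rowCopies_append_colCopies [DecidableEq α] {l : List α} {m : ℕ}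
    (hm : 4 ≤ m) (h : AvoidsAlt l m) : AvoidsAlt (rowCopies l ++ colCopies l) (m + 1) := by
  rintro ⟨x, y⟩ ⟨x', y'⟩ hne hs
  obtain ⟨u, v, huv, hu, hv⟩ := List.sublist_append_iff.1 hs
  obtain ⟨c, d, hcd, hadd, hlast⟩ := altSeq_add (x, y) (x', y') u.length
  have hlen : u.length + v.length = m + 1 := by
    rw [← List.length_append, ← huv, length_altSeq]
  rw [← hlen, hadd] at huv
  obtain ⟨hu', hv'⟩ := List.append_inj huv (length_altSeq _ _ _)
  generalize u.length = i at *
  generalize v.length = j at *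
  subst hu' hv'
  have hrow : x ≠ x' → i ≤ 2 := fun hx =>
    le_two_of_altSeq_sublist_flatMap (key := Prod.fst) (fst_of_mem_row l)
      (List.nodup_dedup _) hx hu
  have hcol : y ≠ y' → j ≤ 2 := fun hy =>
    le_two_of_altSeq_sublist_flatMap (key := Prod.snd) (snd_of_mem_col l)
      (List.nodup_reverse.2 (List.nodup_dedup _))
      (by rcases hcd with ⟨rfl, rfl⟩ | ⟨rfl, rfl⟩; exacts [hy, hy.symm]) hv
  by_cases hx : x = x'
  · subst hx
    have hy : y ≠ y' := fun hy => hne (by rw [hy])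
    have hi := h.lt_of_sublist hy (altSeq_sublist_of_rowCopies hu)
    have hj := hcol hy
    obtain rfl : j = 2 := by omega
    obtain ⟨w, hw⟩ := hlast (by omega)
    have hcd' : c.2 ≠ d.2 := by rcases hcd with ⟨rfl, rfl⟩ | ⟨rfl, rfl⟩; exacts [hy, hy.symm]
    have hdc : [d.2, c.2].Sublist l.dedup := by
      have := pair_sublist_of_flatMap (key := Prod.snd) (snd_of_mem_col l) hcd' hv
      simpa using this.reverse
    have hul := altSeq_sublist_of_rowCopies hu
    have hmap := congrArg (List.map Prod.snd) hw
    rw [map_altSeq] at hmap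
    simp only [List.map_append, List.map_cons, List.map_nil] at hmap
    rw [hmap] at hul
    have hlong := append_pair_sublist_of_dedup hdc hul
    have hsucc := congrArg (List.map Prod.snd) (hadd 1)
    rw [hw] at hsucc
    simp only [map_altSeq, List.map_append, List.map_cons, List.map_nil, altSeq,
      List.append_assoc, List.cons_append, List.nil_append] at hsucc
    rw [← hsucc] at hlong
    have := h.lt_of_sublist (n := i + 1) hy hlong
    omega
  · have hi := hrow hx
    by_cases hy : y = y'
    · subst hy
      have hcol' : j < m := by
        rcases hcd with ⟨rfl, rfl⟩ | ⟨rfl, rfl⟩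
        · exact h.lt_of_sublist hx (altSeq_sublist_of_colCopies hv)
        · exact h.lt_of_sublist (Ne.symm hx) (altSeq_sublist_of_colCopies hv)
      obtain rfl : i = 2 := by omega
      have h3 := hadd 1
      simp only [altSeq, List.cons_append, List.nil_append, List.cons.injEq, and_true,
        true_and] at h3
      have hd : d = (x', y) := by
        rcases hcd with h' | h'
        · exact h'.2
        · exact absurd (congrArg Prod.fst (h3.trans h'.1)) hx
      subst h3 hd
      have hvl := altSeq_sublist_of_colCopies hv
      obtain ⟨j, rfl⟩ : ∃ i, j = i + 1 := ⟨j - 1, by omega⟩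
      have hpair : [x, x'].Sublist l.reverse.dedup :=
        pair_sublist_of_flatMap (key := Prod.fst) (fst_of_mem_row l) (p := (x, y))
          (q := (x', y)) hx hu
      have hrev := hvl.reverse
      simp only [altSeq, List.reverse_cons] at hrev
      have hlong := (append_pair_sublist_of_dedup hpair hrev).reverse
      simp only [List.reverse_append, List.reverse_reverse, List.reverse_cons,
        List.reverse_nil, List.nil_append, List.cons_append] at hlong
      have := h.lt_of_sublist (n := j + 2) (Ne.symm hx) hlong
      omega
    · have := hcol hy
      omega

theorem count_flatMap_of_key {β : Type*} [BEq β] [LawfulBEq β] {key : β → α}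
    {f : α → List β} (hf : ∀ x, ∀ p ∈ f x, key p = x) {L : List α} (hL : L.Nodup) {p : β}
    (hp : key p ∈ L) :
    (L.flatMap f).count p = (f (key p)).count p := by
  induction L with
  | nil => simp at hp
  | cons z L ih =>
    rw [List.nodup_cons] at hL
    rw [List.flatMap_cons, List.count_append]
    by_cases hz : key p = z
    · have : p ∉ L.flatMap f := by
        intro hmem
        obtain ⟨y, hy, hpy⟩ := List.mem_flatMap.1 hmem
        exact hL.1 (by rwa [← hz, hf y p hpy])
      rw [List.count_eq_zero_of_not_mem this, hz, Nat.add_zero]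
    · rw [List.count_eq_zero_of_not_mem fun hmem => hz (hf z p hmem), Nat.zero_add]
      exact ih hL.2 ((List.mem_cons.1 hp).resolve_left hz)

theorem count_rowCopies_append_colCopies [DecidableEq α] {l : List α} (hl : ∀ a, a ∈ l)
    (x y : α) :
    (rowCopies l ++ colCopies l).count (x, y) = l.count y + l.count x := by
  rw [List.count_append, rowCopies, colCopies,
    count_flatMap_of_key (key := Prod.fst) (fst_of_mem_row l) (List.nodup_dedup _)
      (by simp [hl]),
    count_flatMap_of_key (key := Prod.snd) (snd_of_mem_col l)
      (List.nodup_reverse.2 (List.nodup_dedup _)) (by simp [hl])]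
  congr 1
  · exact List.count_map_of_injective l _ (fun _ _ h => congrArg Prod.snd h) y
  · exact List.count_map_of_injective l (fun x => (x, y)) (fun _ _ h => congrArg Prod.fst h) x

end Square

theorem stmt1 (k : ℕ) :
    ∃ l : List (Fin (2 ^ 2 ^ k)),
      (∀ a : Fin (2 ^ 2 ^ k), l.count a = 2 ^ k) ∧ AvoidsAlt l (k + 4) := by
  induction k with
  | zero =>
    refine ⟨[0, 1], by decide, fun a b _ hs => ?_⟩
    have := hs.length_le
    simp [length_altSeq] at this
  | succ k ih =>
    obtain ⟨l, hcount, havoid⟩ := ih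
    have hmem : ∀ a, a ∈ l := fun a => List.count_pos_iff.1 (by rw [hcount]; positivity)
    have e : Fin (2 ^ 2 ^ k) × Fin (2 ^ 2 ^ k) ≃ Fin (2 ^ 2 ^ (k + 1)) :=
      Fintype.equivFinOfCardEq (by simp only [Fintype.card_prod, Fintype.card_fin]; ring)
    refine ⟨(rowCopies l ++ colCopies l).map e, fun a => ?_, ?_⟩
    · obtain ⟨⟨x, y⟩, rfl⟩ := e.surjective a
      rw [List.count_map_of_injective _ _ e.injective, count_rowCopies_append_colCopies hmem,
        hcount, hcount]
      ring
    · have := (havoid.rowCopies_append_colCopies (by omega)).map e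
      rwa [show k + 1 + 4 = k + 4 + 1 by omega]
end

section
/- Let q be a prime power and t ≥ 2 an integer. Then there exists a q² × q^t 0-1 matrix that avoids t×2 all-1 submatrices, contains exactly q^(t+1) 1-entries, and in which every row contains exactly q^(t-1) 1-entries and every column contains exactly q 1-entries. In particular, z(q², q^t; t, 2) ≥ q^(t+1). -/
def Ones {m n : ℕ} (M : Fin m → Fin n → Bool) : ℕ :=
  (Finset.univ.filter fun p : Fin m × Fin n => M p.1 p.2 = true).card

/-- `M` avoids `s × t` all-1 submatrices: there are no `s` rows and `t` columns
all of whose `s * t` intersection entries equal 1. -/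
def AvoidsAllOnes {m n : ℕ} (M : Fin m → Fin n → Bool) (s t : ℕ) : Prop :=
  ¬ ∃ (R : Finset (Fin m)) (C : Finset (Fin n)),
      R.card = s ∧ C.card = t ∧ ∀ i ∈ R, ∀ j ∈ C, M i j = true

/-- `zar m n s t` is the maximum number of 1-entries in an `m × n` 0-1 matrix
avoiding `s × t` all-1 submatrices. -/
noncomputable def zar (m n s t : ℕ) : ℕ :=
  sSup { k | ∃ M : Fin m → Fin n → Bool, AvoidsAllOnes M s t ∧ Ones M = k }

open Finset in
/-- A point `(x, y)` lies on the graph of exactly `|F| ^ k` polynomial functions given by `k + 1`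
coefficients. -/
theorem card_filter_sum_mul_pow_eq {F : Type*} [Field F] [Fintype F] [DecidableEq F]
    (k : ℕ) (x y : F) :
    #{c : Fin (k + 1) → F | ∑ i, c i * x ^ (i : ℕ) = y} = Fintype.card F ^ k := by
  have hcard : #(univ : Finset (Fin k → F)) = Fintype.card F ^ k := by simp
  rw [← hcard]
  refine Finset.card_nbij' Fin.tail
    (fun d => Fin.cons (y - ∑ i, d i * x ^ ((i : ℕ) + 1)) d) ?_ ?_ ?_ ?_
  · simp
  · intro d _
    simp [Fin.sum_univ_succ]
  · intro c hc
    have hc : ∑ i, c i * x ^ (i : ℕ) = y := by simpa using hc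
    rw [Fin.sum_univ_succ] at hc
    conv_rhs => rw [← Fin.cons_self_tail c]
    rw [← hc]
    simp [Fin.tail]
  · intro d _
    simp

/-- A polynomial function with `t` coefficients is determined by its values at `t` points. -/
theorem eq_of_sum_mul_pow_eq {F : Type*} [Field F] {t : ℕ} {c d : Fin t → F} {f : Fin t → F}
    (hf : Function.Injective f)
    (h : ∀ j, ∑ i, c i * f j ^ (i : ℕ) = ∑ i, d i * f j ^ (i : ℕ)) : c = d := by
  refine sub_eq_zero.mp (Matrix.eq_zero_of_forall_index_sum_mul_pow_eq_zero hf fun j => ?_)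
  simp [sub_mul, h]

theorem ones_eq_sum_card_filter {m n : ℕ} (M : Fin m → Fin n → Bool) :
    Ones M = ∑ j, (Finset.univ.filter fun i => M i j = true).card := by
  simp only [Ones, Finset.card_filter]
  exact Fintype.sum_prod_type_right _

theorem ones_le_zar {m n s t : ℕ} {M : Fin m → Fin n → Bool} (hM : AvoidsAllOnes M s t) :
    Ones M ≤ zar m n s t := by
  refine le_csSup ⟨Fintype.card (Fin m × Fin n), ?_⟩ ⟨M, hM, rfl⟩
  rintro _ ⟨N, -, rfl⟩
  exact Finset.card_le_univ _

/-- The incidence matrix between the points of `F × F` and the graphs of polynomials of degree less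
than `t` over a finite field `F`. -/
theorem exists_matrix_avoidsAllOnes {F : Type*} [Field F] [Fintype F] {q t : ℕ}
    (hF : Fintype.card F = q) (ht : 1 ≤ t) :
    ∃ M : Fin (q ^ 2) → Fin (q ^ t) → Bool,
      AvoidsAllOnes M t 2 ∧
      (∀ i : Fin (q ^ 2), (Finset.univ.filter fun j => M i j = true).card = q ^ (t - 1)) ∧
      (∀ j : Fin (q ^ t), (Finset.univ.filter fun i => M i j = true).card = q) := by
  classical
  let e : Fin (q ^ 2) ≃ F × F := (Fintype.equivFinOfCardEq (by simp [hF, sq])).symm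
  let g : Fin (q ^ t) ≃ (Fin t → F) := (Fintype.equivFinOfCardEq (by simp [hF])).symm
  refine ⟨fun i j => decide (∑ l, g j l * (e i).1 ^ (l : ℕ) = (e i).2), ?_, fun i => ?_,
    fun j => ?_⟩
  · rintro ⟨R, C, hR, hC, h⟩
    simp only [decide_eq_true_eq] at h
    obtain ⟨a, b, hab, rfl⟩ := Finset.card_eq_two.mp hC
    let r : Fin t ≃ R := (R.equivFinOfCardEq hR).symm
    refine hab (g.injective (eq_of_sum_mul_pow_eq (f := fun l => (e (r l)).1) ?_ fun l => ?_))
    · intro k l hkl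
      have hk := h (r k) (r k).2 a (by simp)
      have hl := h (r l) (r l).2 a (by simp)
      have hkl : (e (r k)).1 = (e (r l)).1 := hkl
      rw [hkl] at hk
      exact r.injective (Subtype.ext (e.injective (Prod.ext hkl (hk.symm.trans hl))))
    · rw [h _ (r l).2 a (by simp), h _ (r l).2 b (by simp)]
  · obtain ⟨k, rfl⟩ := Nat.exists_eq_add_of_le' ht
    rw [Nat.add_sub_cancel]
    refine Eq.trans ?_ ((card_filter_sum_mul_pow_eq k (e i).1 (e i).2).trans (by rw [hF]))
    exact Finset.card_equiv g (by simp)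
  · refine Eq.trans ?_ (Finset.card_univ.trans hF)
    refine Finset.card_nbij' (fun i => (e i).1)
      (fun x => e.symm (x, ∑ l, g j l * x ^ (l : ℕ))) ?_ ?_ ?_ ?_
    · simp
    · intro x _
      simp
    · intro i hi
      have hi : ∑ l, g j l * (e i).1 ^ (l : ℕ) = (e i).2 := by simpa using hi
      simp [hi]
    · intro x _
      simp

theorem stmt5 (q t : ℕ) (hq : IsPrimePow q) (ht : 2 ≤ t) :
    (∃ M : Fin (q ^ 2) → Fin (q ^ t) → Bool,
      AvoidsAllOnes M t 2 ∧ Ones M = q ^ (t + 1) ∧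
      (∀ i : Fin (q ^ 2), (Finset.univ.filter fun j => M i j = true).card = q ^ (t - 1)) ∧
      (∀ j : Fin (q ^ t), (Finset.univ.filter fun i => M i j = true).card = q)) ∧
    q ^ (t + 1) ≤ zar (q ^ 2) (q ^ t) t 2 := by
  obtain ⟨p, n, hp, hn, rfl⟩ := (isPrimePow_nat_iff _).mp hq
  have : Fact p.Prime := ⟨hp⟩
  have := Fintype.ofFinite (GaloisField p n)
  have hF : Fintype.card (GaloisField p n) = p ^ n := by
    rw [← Nat.card_eq_fintype_card, GaloisField.card p n hn.ne']
  obtain ⟨M, hM, hrow, hcol⟩ := exists_matrix_avoidsAllOnes hF (one_le_two.trans ht)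
  have hones : Ones M = (p ^ n) ^ (t + 1) := by
    rw [ones_eq_sum_card_filter, Finset.sum_congr rfl fun j _ => hcol j]
    simp [pow_succ]
  exact ⟨⟨M, hM, hones, hrow, hcol⟩, hones ▸ ones_le_zar hM⟩
end

section
/- Let t ≥ 2, q ≥ t, σ ≥ 2, and m ≥ 1 be integers. Let Σ be a finite alphabet and let C₁, …, C_m be subsets of Σ such that every symbol of Σ belongs to exactly q of the sets C_i and every pair of distinct symbols belongs to at most t−1 common sets C_i. For each i, let S_i be a finite sequence whose symbols all lie in C_i and which avoids alternations of length σ+1. Then the concatenation S₁·S₂·⋯·S_m avoids alternations of length (t−1)σ + 2(q−t+1) + 1 (i.e., its longest alternating subsequence between any two distinct symbols has length at most (t−1)σ + 2(q−t+1)). -/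
theorem altSeq_sublist_of_le {α : Type*} {j k : ℕ} (h : j ≤ k) (a b : α) :
    (altSeq a b j).Sublist (altSeq a b k) := by
  induction j generalizing a b k with
  | zero => exact List.nil_sublist _
  | succ j ih =>
    obtain ⟨k, rfl⟩ : ∃ k', k = k' + 1 := ⟨k - 1, by omega⟩
    exact (ih (by omega) b a).cons_cons a

theorem altSeq_eq_append {α : Type*} (l₁ l₂ : List α) (a b : α) (k : ℕ)
    (h : altSeq a b k = l₁ ++ l₂) :
    ∃ i j, k = i + j ∧ l₁ = altSeq a b i ∧ (l₂ = altSeq a b j ∨ l₂ = altSeq b a j) := by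
  induction l₁ generalizing a b k with
  | nil => exact ⟨0, k, by omega, rfl, Or.inl h.symm⟩
  | cons x l ih =>
    cases k with
    | zero => simp [altSeq] at h
    | succ k =>
      simp only [altSeq, List.cons_append, List.cons.injEq] at h
      obtain ⟨i, j, hk, hl, hj⟩ := ih b a k h.2
      exact ⟨i + 1, j, by omega, by rw [altSeq, ← hl, h.1], hj.symm⟩

/-- Every alternation of `a` and `b` in `l`, starting with either symbol, has length at most
`n`. -/
def AltLengthLE {α : Type*} (a b : α) (l : List α) (n : ℕ) : Prop :=
  ∀ k, (altSeq a b k).Sublist l ∨ (altSeq b a k).Sublist l → k ≤ n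

theorem AltLengthLE.symm {α : Type*} {a b : α} {l : List α} {n : ℕ}
    (h : AltLengthLE a b l n) : AltLengthLE b a l n :=
  fun k hk => h k hk.symm

theorem AltLengthLE.append {α : Type*} {a b : α} {l₁ l₂ : List α} {n₁ n₂ : ℕ}
    (h₁ : AltLengthLE a b l₁ n₁) (h₂ : AltLengthLE a b l₂ n₂) :
    AltLengthLE a b (l₁ ++ l₂) (n₁ + n₂) := by
  have key : ∀ c d : α, AltLengthLE c d l₁ n₁ → AltLengthLE c d l₂ n₂ →
      ∀ k, (altSeq c d k).Sublist (l₁ ++ l₂) → k ≤ n₁ + n₂ := by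
    intro c d h₁ h₂ k hk
    obtain ⟨r₁, r₂, hr, hs₁, hs₂⟩ := List.sublist_append_iff.1 hk
    obtain ⟨i, j, rfl, rfl, hj⟩ := altSeq_eq_append r₁ r₂ c d k hr
    refine add_le_add (h₁ i (Or.inl hs₁)) (h₂ j ?_)
    rcases hj with rfl | rfl
    · exact Or.inl hs₂
    · exact Or.inr hs₂
  rintro k (hk | hk)
  · exact key a b h₁ h₂ k hk
  · exact key b a h₁.symm h₂.symm k hk

theorem AltLengthLE.flatten_ofFn {α : Type*} {a b : α} {m : ℕ} {S : Fin m → List α}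
    {w : Fin m → ℕ} (h : ∀ i, AltLengthLE a b (S i) (w i)) :
    AltLengthLE a b (List.ofFn S).flatten (∑ i, w i) := by
  induction m with
  | zero =>
    rintro (_ | k) hk
    · simp
    · simp [altSeq] at hk
  | succ m ih =>
    rw [List.ofFn_succ, List.flatten_cons, Fin.sum_univ_succ]
    exact (h 0).append (ih fun i => h i.succ)

theorem AvoidsAlt.altLengthLE {α : Type*} {l : List α} {n : ℕ} (h : AvoidsAlt l (n + 1))
    {a b : α} (hab : a ≠ b) : AltLengthLE a b l n := by
  intro k hk
  by_contra! hn
  rcases hk with hk | hk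
  · exact h a b hab ((altSeq_sublist_of_le hn a b).trans hk)
  · exact h b a hab.symm ((altSeq_sublist_of_le hn b a).trans hk)

theorem altLengthLE_one_of_notMem {α : Type*} {a b : α} {l : List α} (h : b ∉ l) :
    AltLengthLE a b l 1 := by
  rintro (_ | _ | k) hk
  · simp
  · simp
  · rcases hk with hk | hk <;> exact absurd (hk.subset (by simp [altSeq])) h

theorem altLengthLE_zero_of_notMem {α : Type*} {a b : α} {l : List α} (ha : a ∉ l)
    (hb : b ∉ l) : AltLengthLE a b l 0 := by
  rintro (_ | k) hk
  · simp
  · rcases hk with hk | hk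
    · exact absurd (hk.subset (by simp [altSeq])) ha
    · exact absurd (hk.subset (by simp [altSeq])) hb

theorem stmt7 {α : Type*} [Fintype α] [DecidableEq α]
    (t q σ m : ℕ) (ht : 2 ≤ t) (hq : t ≤ q) (hσ : 2 ≤ σ) (hm : 1 ≤ m)
    (C : Fin m → Finset α)
    (hcover : ∀ a : α, (Finset.univ.filter fun i => a ∈ C i).card = q)
    (hpair : ∀ a b : α, a ≠ b →
      (Finset.univ.filter fun i => a ∈ C i ∧ b ∈ C i).card ≤ t - 1)
    (S : Fin m → List α)
    (hmem : ∀ i, ∀ x ∈ S i, x ∈ C i)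
    (havoid : ∀ i, AvoidsAlt (S i) (σ + 1)) :
    AvoidsAlt (List.ofFn S).flatten ((t - 1) * σ + 2 * (q - t + 1) + 1) := by
  intro a b hab hsub
  let w : Fin m → ℕ := fun i =>
    if a ∈ C i ∧ b ∈ C i then σ else (if a ∈ C i then 1 else 0) + (if b ∈ C i then 1 else 0)
  have hw : ∀ i, AltLengthLE a b (S i) (w i) := by
    intro i
    by_cases ha : a ∈ C i <;> by_cases hb : b ∈ C i <;> simp only [w, ha, hb]
    · simpa using (havoid i).altLengthLE hab
    · simpa using altLengthLE_one_of_notMem fun h => hb (hmem i b h)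
    · simpa using (altLengthLE_one_of_notMem fun h => ha (hmem i a h)).symm
    · simpa using altLengthLE_zero_of_notMem (fun h => ha (hmem i a h)) fun h => hb (hmem i b h)
  have hle := AltLengthLE.flatten_ofFn hw _ (Or.inl hsub)
  set c := (Finset.univ.filter fun i => a ∈ C i ∧ b ∈ C i).card with hc
  have hsum : ∑ i, w i + c * 2 = c * σ + q + q := by
    nth_rewrite 2 [← hcover a]
    rw [← hcover b, hc]
    simp only [Finset.card_filter, Finset.sum_mul, ← Finset.sum_add_distrib]
    refine Finset.sum_congr rfl fun i _ => ?_
    by_cases ha : a ∈ C i <;> by_cases hb : b ∈ C i <;> simp [w, ha, hb]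
  have hct : c ≤ t - 1 := hpair a b hab
  obtain ⟨d, hd⟩ := Nat.exists_eq_add_of_le hct
  obtain ⟨s, rfl⟩ := Nat.exists_eq_add_of_le hσ
  have hqt : q - t + 1 + (t - 1) = q := by omega
  rw [hd] at hle hqt
  nlinarith [Nat.zero_le (d * s)]
end

section
/- Let q be a prime power and ŝ an integer with 1 ≤ ŝ ≤ q. Then there exists a (q·ŝ) × q² 0-1 matrix that avoids 2×2 all-1 submatrices, in which every row contains exactly q 1-entries and every column contains exactly ŝ 1-entries. -/
/-- The incidence matrix of the points `(x, y)` of the affine plane over a finite field with the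
lines `y = a i * x + b`, whose slopes `a i` are distinct. -/
theorem exists_lineIncidence_matrix (F : Type*) [Field F] [Fintype F] (s : ℕ) (a : Fin s ↪ F)
    (m n : ℕ) (e : Fin m ≃ F × Fin s) (c : Fin n ≃ F × F) :
    ∃ M : Fin m → Fin n → Bool,
      AvoidsAllOnes M 2 2 ∧
      (∀ i : Fin m, (Finset.univ.filter fun j => M i j = true).card = Fintype.card F) ∧
      (∀ j : Fin n, (Finset.univ.filter fun i => M i j = true).card = s) := by
  classical
  refine ⟨fun i j => decide ((c j).2 = a (e i).2 * (c j).1 + (e i).1), ?_, fun i => ?_,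
    fun j => ?_⟩
  · rintro ⟨R, C, hR, hC, h⟩
    obtain ⟨i, i', hi, rfl⟩ := Finset.card_eq_two.mp hR
    obtain ⟨j, j', hj, rfl⟩ := Finset.card_eq_two.mp hC
    simp only [Finset.mem_insert, Finset.mem_singleton, decide_eq_true_eq] at h
    have h₁ := h i (.inl rfl) j (.inl rfl)
    have h₂ := h i (.inl rfl) j' (.inr rfl)
    have h₃ := h i' (.inr rfl) j (.inl rfl)
    have h₄ := h i' (.inr rfl) j' (.inr rfl)
    have hprod : (a (e i).2 - a (e i').2) * ((c j).1 - (c j').1) = 0 := by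
      linear_combination -h₁ + h₂ + h₃ - h₄
    rcases mul_eq_zero.mp hprod with hs | hx
    · have hs := sub_eq_zero.mp hs
      refine hi (e.injective (Prod.ext ?_ (a.injective hs)))
      linear_combination -h₁ + h₃ - (c j).1 * hs
    · have hx := sub_eq_zero.mp hx
      refine hj (c.injective (Prod.ext hx ?_))
      linear_combination h₁ - h₂ + a (e i).2 * hx
  · rw [← Finset.card_univ]
    refine Finset.card_nbij' (fun j => (c j).1)
      (fun x => c.symm (x, a (e i).2 * x + (e i).1)) ?_ ?_ ?_ ?_
    · simp [Set.MapsTo]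
    · simp [Set.MapsTo]
    · intro j hj
      simp only [Finset.coe_filter, Finset.mem_univ, true_and, Set.mem_ofPred_eq,
        decide_eq_true_eq] at hj
      simp [← hj]
    · simp [Set.LeftInvOn]
  · conv_rhs => rw [← Finset.card_fin s]
    refine Finset.card_nbij' (fun i => (e i).2)
      (fun k => e.symm ((c j).2 - a k * (c j).1, k)) ?_ ?_ ?_ ?_
    · simp [Set.MapsTo]
    · simp [Set.MapsTo]
    · intro i hi
      simp only [Finset.coe_filter, Finset.mem_univ, true_and, Set.mem_ofPred_eq,
        decide_eq_true_eq] at hi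
      simp [hi]
    · simp [Set.LeftInvOn]

theorem stmt10 (q s : ℕ) (hq : IsPrimePow q) (hs1 : 1 ≤ s) (hsq : s ≤ q) :
    ∃ M : Fin (q * s) → Fin (q ^ 2) → Bool,
      AvoidsAllOnes M 2 2 ∧
      (∀ i : Fin (q * s), (Finset.univ.filter fun j => M i j = true).card = q) ∧
      (∀ j : Fin (q ^ 2), (Finset.univ.filter fun i => M i j = true).card = s) := by
  have : Nonempty (Fin q) := ⟨⟨0, by omega⟩⟩
  obtain ⟨_⟩ : Nonempty (Field (Fin q)) := Fintype.nonempty_field_iff.mpr (by simpa using hq)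
  simpa using exists_lineIncidence_matrix (Fin q) s (Fin.castLEEmb hsq) (q * s) (q ^ 2)
    finProdFinEquiv.symm ((finCongr (sq q)).trans finProdFinEquiv.symm)
end
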